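/- arXiv:2210.02384 — 3 statements merged into one kernel-verified Lean document; each statement's English description precedes it below -/
import Mathlib

section
/- Let F be a field of characteristic different from 2 and let H be a square-effective subring of F with fraction field F. Let k ∈ ℕ⁺. Then Σₖ F² = F² · (1 + Σₖ₋₁ H²). Moreover, if 1 + Σₖ₋₁ H² ⊆ H^×, then H ∩ Σₖ F² = Σₖ H². -/
open scoped Pointwise

universe u

namespace SosPaper

/-- The set of sums of `k` squares in a commutative ring. -/
def sumSq (A : Type*) [CommRing A] (k : ℕ) : Set A :=
  {x | ∃ f : Fin k → A, x = ∑ i, f i ^ 2}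

/-- The set of sums of squares in a commutative ring. -/
def sums (A : Type*) [CommRing A] : Set A := ⋃ k, sumSq A k

/-- The Pythagoras number of a commutative ring, as an extended natural number:
the least `k` such that every sum of squares is a sum of `k` squares. -/
noncomputable def pyth (A : Type*) [CommRing A] : ℕ∞ :=
  sInf ((fun k : ℕ => (k : ℕ∞)) '' {k : ℕ | sums A ⊆ sumSq A k})

/-- The level of a commutative ring: the least `k` such that `-1` is a sum of
`k` squares. -/
noncomputable def level (A : Type*) [CommRing A] : ℕ∞ :=
  sInf ((fun k : ℕ => (k : ℕ∞)) '' {k : ℕ | (-1 : A) ∈ sumSq A k})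

/-- A subring `H` of a field (or commutative ring) `A` has `A` as its field of
fractions: every element of `A` is a quotient of two elements of `H`. -/
def IsFractionSubring {A : Type*} [CommRing A] (H : Subring A) : Prop :=
  ∀ x : A, ∃ a b : H, b ≠ 0 ∧ x * b = a

/-- The invariant `p*(H)`: the least `k` such that every unit of `H` that is a
sum of squares in the ambient ring is a sum of `k` squares in the ambient ring. -/
noncomputable def pstar {A : Type*} [CommRing A] (H : Subring A) : ℕ∞ :=
  sInf ((fun k : ℕ => (k : ℕ∞)) '' {k : ℕ | ∀ h : H, IsUnit h → (h : A) ∈ sums A → (h : A) ∈ sumSq A k})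

/-- A commutative ring is semilocal if it has only finitely many maximal ideals. -/
def Semilocal (A : Type*) [CommRing A] : Prop := {I : Ideal A | I.IsMaximal}.Finite

/-- The `H`-submodule `f·H` of the ambient ring, as a set. -/
def mulSet {A : Type*} [CommRing A] (H : Subring A) (f : A) : Set A :=
  {x | ∃ h ∈ H, x = f * h}

/-- A subring `H` of a field `F` (with fraction field `F`) is square-effective if
every sum of two squares of elements of `F` can be rewritten as `g₁² + g₂²` with
`f₁H + f₂H = g₁H ⊇ g₂H`. -/
def SquareEffective {A : Type*} [CommRing A] (H : Subring A) : Prop :=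
  ∀ f₁ f₂ : A, ∃ g₁ g₂ : A, f₁ ^ 2 + f₂ ^ 2 = g₁ ^ 2 + g₂ ^ 2 ∧
    mulSet H f₁ + mulSet H f₂ = mulSet H g₁ ∧ mulSet H g₂ ⊆ mulSet H g₁

/-- The two defining conditions for a (semilocal Bézout) domain `H` to be
square-effective of order `n`:
`1 + Σ_{2ⁿ−1} H² ⊆ H^×` and `(1 + Σ_{2ⁿ} H²) ∩ Jac(H) ≠ ∅`. -/
def SqEffOrder {A : Type*} [CommRing A] (H : Subring A) (n : ℕ) : Prop :=
  (∀ x : H, x ∈ sumSq H (2 ^ n - 1) → IsUnit (1 + x)) ∧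
  ∃ x : H, x ∈ sumSq H (2 ^ n) ∧ 1 + x ∈ Ideal.jacobson (⊥ : Ideal H)

/-- A field `F` is `n`-effective if it has a semilocal Bézout subring `H` with
fraction field `F` which is square-effective of order `n` and with `p*(H) ≤ 2ⁿ`. -/
def IsNEffective (n : ℕ) (F : Type*) [Field F] : Prop :=
  ∃ H : Subring F, IsFractionSubring H ∧ Semilocal H ∧ IsBezout H ∧
    SqEffOrder H n ∧ pstar H ≤ ((2 ^ n : ℕ) : ℕ∞)

/-- A subring `H` of `F` characterises sums of `k` squares in `F` if every unit
of `H` which is a sum of squares in `F` and whose residue modulo every maximal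
ideal of `H` is a sum of `k` squares is itself a sum of `k` squares in `F`. -/
def Characterises {A : Type*} [CommRing A] (H : Subring A) (k : ℕ) : Prop :=
  ∀ h : H, IsUnit h → (h : A) ∈ sums A →
    (∀ m : Ideal H, m.IsMaximal → Ideal.Quotient.mk m h ∈ sumSq (H ⧸ m) k) →
    (h : A) ∈ sumSq A k

/-- A function field in one variable over `K`: a finitely generated field
extension of transcendence degree 1, equivalently a finite extension of a
subfield `K(x)` with `x` transcendental over `K`. -/
def IsFunctionFieldOneVar (K F : Type*) [Field K] [Field F] [Algebra K F] : Prop :=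
  ∃ x : F, Transcendental K x ∧ FiniteDimensional (IntermediateField.adjoin K {x}) F

/-- A `𝒫ₙ`-field: `p(K(X)) ≤ 2^{n+1}` and every function field in one variable
over `K` with Pythagoras number `> 2^{n+1}` is `(n+1)`-effective. -/
def IsPnField (n : ℕ) (K : Type u) [Field K] : Prop :=
  pyth (RatFunc K) ≤ ((2 ^ (n + 1) : ℕ) : ℕ∞) ∧
  ∀ (F : Type u) [Field F] [Algebra K F], IsFunctionFieldOneVar K F →
    ((2 ^ (n + 1) : ℕ) : ℕ∞) < pyth F → IsNEffective (n + 1) F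


theorem mem_sumSq_succ {A : Type*} [CommRing A] {n : ℕ} {x : A} :
    x ∈ sumSq A (n + 1) ↔ ∃ a : A, ∃ y ∈ sumSq A n, x = a ^ 2 + y := by
  constructor
  · rintro ⟨f, rfl⟩
    exact ⟨f 0, _, ⟨fun i => f i.succ, rfl⟩, Fin.sum_univ_succ _⟩
  · rintro ⟨a, y, ⟨f, rfl⟩, rfl⟩
    exact ⟨Fin.cons a f, by simp [Fin.sum_univ_succ]⟩

theorem sq_mul_mem_sumSq {A : Type*} [CommRing A] {n : ℕ} {x : A} (c : A)
    (hx : x ∈ sumSq A n) : c ^ 2 * x ∈ sumSq A n := by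
  obtain ⟨f, rfl⟩ := hx
  exact ⟨fun i => c * f i, by simp [Finset.mul_sum, mul_pow]⟩

theorem map_mem_sumSq {A B : Type*} [CommRing A] [CommRing B] (φ : A →+* B) {n : ℕ} {x : A}
    (hx : x ∈ sumSq A n) : φ x ∈ sumSq B n := by
  obtain ⟨f, rfl⟩ := hx
  exact ⟨fun i => φ (f i), by simp⟩

theorem sq_mul_one_add_mem_sumSq {A : Type*} [CommRing A] {n : ℕ} {s : A} (c : A)
    (hs : s ∈ sumSq A n) : c ^ 2 * (1 + s) ∈ sumSq A (n + 1) :=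
  mem_sumSq_succ.2 ⟨c, c ^ 2 * s, sq_mul_mem_sumSq c hs, by ring⟩

theorem zero_mem_mulSet {A : Type*} [CommRing A] (H : Subring A) (f : A) :
    (0 : A) ∈ mulSet H f :=
  ⟨0, H.zero_mem, by simp⟩

theorem self_mem_mulSet {A : Type*} [CommRing A] (H : Subring A) (f : A) : f ∈ mulSet H f :=
  ⟨1, H.one_mem, by simp⟩

theorem left_mem_mulSet_add {A : Type*} [CommRing A] (H : Subring A) (f g : A) :
    f ∈ mulSet H f + mulSet H g :=
  ⟨f, self_mem_mulSet H f, 0, zero_mem_mulSet H g, add_zero f⟩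

theorem right_mem_mulSet_add {A : Type*} [CommRing A] (H : Subring A) (f g : A) :
    g ∈ mulSet H f + mulSet H g :=
  ⟨0, zero_mem_mulSet H f, g, self_mem_mulSet H g, zero_add g⟩

/-- A sum of squares can be normalised so that one term divides all the others over `H`. -/
theorem SquareEffective.exists_eq_sq_mul_one_add {A : Type*} [CommRing A] {H : Subring A}
    (hse : SquareEffective H) {n : ℕ} {x : A} (hx : x ∈ sumSq A (n + 1)) :
    ∃ c : A, ∃ s : H, s ∈ sumSq H n ∧ x = c ^ 2 * ((1 + s : H) : A) := by
  induction n generalizing x with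
  | zero =>
    obtain ⟨f, rfl⟩ := hx
    exact ⟨f 0, 0, ⟨Fin.elim0, by simp⟩, by simp⟩
  | succ n ih =>
    obtain ⟨f, y, hy, rfl⟩ := mem_sumSq_succ.1 hx
    obtain ⟨g, s, hs, rfl⟩ := ih hy
    obtain ⟨g₁, g₂, hsum, hadd, hsub⟩ := hse f g
    obtain ⟨b, hb, hgb⟩ := hadd ▸ right_mem_mulSet_add H f g
    obtain ⟨d, hd, hgd⟩ := hsub (self_mem_mulSet H g₂)
    refine ⟨g₁, (⟨d, hd⟩ : H) ^ 2 + (⟨b, hb⟩ : H) ^ 2 * s,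
      mem_sumSq_succ.2 ⟨_, _, sq_mul_mem_sumSq _ hs, rfl⟩, ?_⟩
    push_cast
    calc f ^ 2 + g ^ 2 * (1 + (s : A)) = g₁ ^ 2 + g₂ ^ 2 + g ^ 2 * s := by rw [← hsum]; ring
      _ = g₁ ^ 2 * (1 + (d ^ 2 + b ^ 2 * s)) := by rw [hgd, hgb]; ring

theorem SquareEffective.mem_of_sq_mem {A : Type*} [CommRing A] {H : Subring A}
    (hse : SquareEffective H) {c : A} (hc : c ^ 2 ∈ H) : c ∈ H := by
  obtain ⟨g, -, -, hadd, -⟩ := hse 1 c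
  obtain ⟨a, ha, hga⟩ := hadd ▸ left_mem_mulSet_add H 1 c
  obtain ⟨b, hb, hgb⟩ := hadd ▸ right_mem_mulSet_add H 1 c
  obtain ⟨_, ⟨u, hu, rfl⟩, _, ⟨v, hv, rfl⟩, huv⟩ := hadd.symm ▸ self_mem_mulSet H g
  have huv : 1 * u + c * v = g := huv
  have key : c = b * u + a * v * c ^ 2 := by
    linear_combination (c - u * b) * hga + u * a * hgb - c * a * huv
  rw [key]
  exact H.add_mem (H.mul_mem hb hu) (H.mul_mem (H.mul_mem ha hv) hc)

theorem statement2 {F : Type*} [Field F] (hchar : ringChar F ≠ 2)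
    (H : Subring F) (hfrac : IsFractionSubring H) (hse : SquareEffective H)
    (k : ℕ) (hk : 0 < k) :
    sumSq F k =
      {x : F | ∃ c : F, ∃ s : H, s ∈ sumSq H (k - 1) ∧ x = c ^ 2 * ((1 + s : H) : F)} ∧
    ((∀ s : H, s ∈ sumSq H (k - 1) → IsUnit (1 + s)) →
      {h : H | (h : F) ∈ sumSq F k} = sumSq H k) := by
  obtain ⟨n, rfl⟩ := Nat.exists_eq_succ_of_ne_zero hk.ne'
  simp only [Nat.succ_eq_add_one, Nat.add_sub_cancel]
  refine ⟨Set.Subset.antisymm (fun x hx => hse.exists_eq_sq_mul_one_add hx) ?_,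
    fun hunit => Set.Subset.antisymm ?_ fun h hh => map_mem_sumSq H.subtype hh⟩
  · rintro _ ⟨c, s, hs, rfl⟩
    push_cast
    exact sq_mul_one_add_mem_sumSq c (map_mem_sumSq H.subtype hs)
  · intro h hh
    obtain ⟨c, s, hs, hcs⟩ := hse.exists_eq_sq_mul_one_add hh
    obtain ⟨t, ht⟩ := (hunit s hs).exists_right_inv
    have hc : c ^ 2 = ((h * t : H) : F) := by
      have ht' : ((1 + s : H) : F) * (t : F) = 1 := by
        rw [← Subring.coe_mul, ht, Subring.coe_one]
      rw [Subring.coe_mul, hcs, mul_assoc, ht', mul_one]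
    have hcH : c ∈ H := hse.mem_of_sq_mem (hc ▸ (h * t).2)
    have hh' : h = (⟨c, hcH⟩ : H) ^ 2 * (1 + s) := Subtype.ext (by simpa using hcs)
    rw [hh']
    exact sq_mul_one_add_mem_sumSq _ hs

end SosPaper
end

section
/- Let F be a field of characteristic different from 2 and let H be a semilocal Bézout subring of F with fraction field F such that 1 + H² ⊆ H^×. Then H is square-effective. -/
open scoped Pointwise

universe u

namespace SosPaper

/-- In a semilocal ring in which `2` is a unit, a unimodular pair `(a, b)` can be rotated
(up to the factor `1 + t ^ 2`) so that its first entry becomes a unit. -/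
theorem Semilocal.exists_isUnit_rotation {R : Type*} [CommRing R] (hR : Semilocal R)
    (h2 : IsUnit (2 : R)) {a b : R} (hab : IsCoprime a b) :
    ∃ t : R, IsUnit ((1 - t ^ 2) * a + 2 * t * b) := by
  classical
  have : Finite {I : Ideal R | I.IsMaximal} := hR
  obtain ⟨t, ht⟩ := Ideal.exists_forall_sub_mem_ideal
    (I := fun I : {I : Ideal R | I.IsMaximal} => (I : Ideal R))
    (fun I J hIJ => by
      have : (I : Ideal R).IsMaximal := I.2
      have : (J : Ideal R).IsMaximal := J.2
      exact Ideal.isCoprime_of_isMaximal (Subtype.coe_injective.ne hIJ))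
    (fun I => if a ∈ (I : Ideal R) then (1 : R) else 0)
  refine ⟨t, ?_⟩
  by_contra hu
  obtain ⟨m, hm, hum⟩ := exists_max_ideal_of_mem_nonunits hu
  have htm : t - (if a ∈ m then (1 : R) else 0) ∈ m := ht ⟨m, hm⟩
  split_ifs at htm with ha
  · have h2b : 2 * b ∈ m := by
      have h := m.sub_mem (m.sub_mem hum (m.mul_mem_left (1 - t ^ 2) ha))
        (m.mul_mem_left (2 * b) htm)
      convert h using 1
      ring
    have hb : b ∈ m := (Ideal.unit_mul_mem_iff_mem m h2).mp h2b
    obtain ⟨x, y, hxy⟩ := hab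
    exact hm.ne_top ((Ideal.eq_top_iff_one m).mpr
      (hxy ▸ m.add_mem (m.mul_mem_left x ha) (m.mul_mem_left y hb)))
  · rw [sub_zero] at htm
    refine ha ?_
    have h := m.sub_mem hum (m.mul_mem_left (2 * b - t * a) htm)
    convert h using 1
    ring

/-- Over a Bézout subring with fraction field `F`, any two elements of `F` that are not both
zero are a common multiple of a unimodular pair. -/
theorem IsFractionSubring.exists_eq_mul_isCoprime {F : Type*} [Field F] {H : Subring F}
    (hfrac : IsFractionSubring H) [IsBezout H] (f₁ f₂ : F) :
    (f₁ = 0 ∧ f₂ = 0) ∨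
      ∃ (d : F) (a b : H), IsCoprime a b ∧ f₁ = d * a ∧ f₂ = d * b := by
  obtain ⟨p, s, hs, hp⟩ := hfrac f₁
  obtain ⟨q, r, hr, hq⟩ := hfrac f₂
  have hs' : (s : F) ≠ 0 := by simpa using hs
  have hr' : (r : F) ≠ 0 := by simpa using hr
  obtain ⟨a, ha⟩ := IsBezout.gcd_dvd_left (p * r) (q * s)
  obtain ⟨b, hb⟩ := IsBezout.gcd_dvd_right (p * r) (q * s)
  obtain ⟨x, y, hxy⟩ := IsBezout.gcd_eq_sum (p * r) (q * s)
  generalize IsBezout.gcd (p * r) (q * s) = e at ha hb hxy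
  have haF : (p : F) * r = e * a := by exact_mod_cast congrArg Subtype.val ha
  have hbF : (q : F) * s = e * b := by exact_mod_cast congrArg Subtype.val hb
  have h₁ : f₁ = e / (s * r) * a := by
    field_simp
    linear_combination (r : F) * hp + haF
  have h₂ : f₂ = e / (s * r) * b := by
    field_simp
    linear_combination (s : F) * hq + hbF
  by_cases he : e = 0
  · left
    simp [h₁, h₂, he]
  · refine Or.inr ⟨e / (s * r), a, b, ⟨x, y, mul_left_cancel₀ he ?_⟩, h₁, h₂⟩
    linear_combination hxy - x * ha - y * hb

theorem statement9 {F : Type*} [Field F] (hchar : ringChar F ≠ 2)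
    (H : Subring F) (hfrac : IsFractionSubring H) (hsemi : Semilocal H)
    (hbez : IsBezout H) (h1 : ∀ x : H, IsUnit (1 + x ^ 2)) :
    SquareEffective H := by
  intro f₁ f₂
  obtain ⟨rfl, rfl⟩ | ⟨d, a, b, hab, rfl, rfl⟩ := hfrac.exists_eq_mul_isCoprime f₁ f₂
  · refine ⟨0, 0, rfl, ?_, subset_rfl⟩
    have h0 : mulSet H (0 : F) = 0 := by
      ext x
      simpa [mulSet] using fun _ => ⟨0, H.zero_mem⟩
    rw [h0, add_zero]
  have h2 : IsUnit (2 : H) := by simpa [one_add_one_eq_two] using h1 1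
  obtain ⟨t, ht⟩ := hsemi.exists_isUnit_rotation h2 hab
  obtain ⟨w, hw⟩ := (h1 t).exists_right_inv
  obtain ⟨v, hv⟩ := ht.exists_right_inv
  obtain ⟨x, y, hxy⟩ := hab
  have htwo : ((2 : H) : F) = 2 := rfl
  have hwF : (1 + (t : F) ^ 2) * w = 1 := by exact_mod_cast congrArg Subtype.val hw
  have hvF : ((1 - (t : F) ^ 2) * a + 2 * t * b) * v = 1 := by
    simpa [htwo] using congrArg Subtype.val hv
  have hxyF : (x : F) * a + y * b = 1 := by exact_mod_cast congrArg Subtype.val hxy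
  set u : H := ((1 - t ^ 2) * a + 2 * t * b) * w with hu
  set c : H := (2 * t * a - (1 - t ^ 2) * b) * w with hc
  have huF : (u : F) = ((1 - (t : F) ^ 2) * a + 2 * t * b) * w := by
    simp [hu, htwo]
  have hcF : (c : F) = (2 * t * a - (1 - (t : F) ^ 2) * b) * w := by
    simp [hc, htwo]
  have huv : (u : F) * (v * (1 + t ^ 2)) = 1 := by
    rw [huF]
    linear_combination (w : F) * (1 + t ^ 2) * hvF + hwF
  have hle : ∀ z : H, mulSet H (d * z) ⊆ mulSet H (d * u) := by
    rintro z _ ⟨h, hh, rfl⟩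
    refine ⟨_, (v * (1 + t ^ 2) * z * ⟨h, hh⟩ : H).2, ?_⟩
    push_cast
    linear_combination -d * z * h * huv
  refine ⟨d * u, d * c, ?_, ?_, hle c⟩
  · rw [huF, hcF]
    linear_combination
      -d ^ 2 * ((a : F) ^ 2 + b ^ 2) * ((1 + (t : F) ^ 2) * w + 1) * hwF
  · refine Set.Subset.antisymm ?_ ?_
    · rintro _ ⟨z₁, hz₁, z₂, hz₂, rfl⟩
      obtain ⟨k₁, hk₁, rfl⟩ := hle a hz₁
      obtain ⟨k₂, hk₂, rfl⟩ := hle b hz₂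
      exact ⟨k₁ + k₂, H.add_mem hk₁ hk₂, (mul_add _ _ _).symm⟩
    · rintro _ ⟨h, hh, rfl⟩
      refine ⟨_, ⟨_, (x * u * ⟨h, hh⟩ : H).2, rfl⟩, _, ⟨_, (y * u * ⟨h, hh⟩ : H).2, rfl⟩, ?_⟩
      push_cast
      linear_combination d * u * h * hxyF

end SosPaper
end

section
/- Let F be a field and let H be a subring of F with fraction field F. Then H is a semilocal Bézout domain if and only if H is a finite intersection of valuation rings of F (valuation subrings of F). -/
open scoped Pointwise

universe u

namespace SosPaper

section CommRing

variable {R : Type*} [CommRing R]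

theorem dvd_of_forall_isMaximal {a c : R}
    (h : ∀ m : Ideal R, m.IsMaximal → ∃ s ∉ m, c ∣ s * a) : c ∣ a := by
  let I : Ideal R := Submodule.comap (LinearMap.toSpanSingleton R R a) (Ideal.span {c})
  have hI : ∀ s, s ∈ I ↔ c ∣ s * a := fun s => by
    simp [I, Ideal.mem_span_singleton]
  by_cases htop : I = ⊤
  · have h1 : (1 : R) ∈ I := htop ▸ Submodule.mem_top
    simpa using (hI 1).1 h1
  · obtain ⟨m, hm, hIm⟩ := Ideal.exists_le_maximal I htop
    obtain ⟨s, hs, hd⟩ := h m hm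
    exact absurd (hIm ((hI s).2 hd)) hs

/-- In a semilocal ring, prescribed residues `0` and `1` at the maximal ideals can be lifted. -/
theorem Semilocal.exists_sub_mem (hR : Semilocal R) (T : Set (Ideal R)) :
    ∃ x : R, ∀ m : Ideal R, m.IsMaximal → (m ∈ T → x - 1 ∈ m) ∧ (m ∉ T → x ∈ m) := by
  classical
  have : Finite {I : Ideal R | I.IsMaximal} := hR
  have hpair : Pairwise (Function.onFun IsCoprime
      (fun i : {I : Ideal R | I.IsMaximal} => (i : Ideal R))) := fun i j hij => by
    rw [Function.onFun, Ideal.isCoprime_iff_sup_eq]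
    exact i.2.coprime_of_ne j.2 (fun h => hij (Subtype.ext h))
  obtain ⟨x, hx⟩ := Ideal.exists_forall_sub_mem_ideal hpair
    (fun i => if (i : Ideal R) ∈ T then 1 else 0)
  refine ⟨x, fun m hm => ⟨fun hT => ?_, fun hT => ?_⟩⟩
  · simpa [hT] using hx ⟨m, hm⟩
  · simpa [hT] using hx ⟨m, hm⟩

/-- A semilocal ring in which divisibility is total locally at each maximal ideal is Bézout. -/
theorem Semilocal.isBezout (hR : Semilocal R)
    (h : ∀ m : Ideal R, m.IsMaximal → ∀ a b : R,
      (∃ s ∉ m, a ∣ s * b) ∨ ∃ s ∉ m, b ∣ s * a) : IsBezout R := by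
  rw [IsBezout.iff_span_pair_isPrincipal]
  intro a b
  obtain ⟨x, hx⟩ := hR.exists_sub_mem {m | ∃ s ∉ m, a ∣ s * b}
  have key : ∀ m : Ideal R, m.IsMaximal →
      ∃ s ∉ m, (x * a + (1 - x) * b) ∣ s * a ∧ (x * a + (1 - x) * b) ∣ s * b := by
    intro m hm
    have hp := hm.isPrime
    have h1 : (1 : R) ∉ m := fun h => hm.ne_top ((Ideal.eq_top_iff_one m).2 h)
    by_cases hT : ∃ s ∉ m, a ∣ s * b
    · have hx1 := (hx m hm).1 hT
      obtain ⟨s, hs, r, hr⟩ := hT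
      have ht : x * s + (1 - x) * r ∉ m := fun hmem => hs <| by
        have := m.sub_mem hmem (m.mul_mem_left (s - r) hx1)
        convert! this using 1
        ring
      refine ⟨(x * s + (1 - x) * r) * s, fun hmem => (hp.mem_or_mem hmem).elim ht hs,
        ⟨s * s, ?_⟩, ⟨r * s, ?_⟩⟩
      · linear_combination (-(s * (1 - x))) * hr
      · linear_combination (x * s + (1 - x) * r) * hr - r * (1 - x) * hr
    · have hx0 := (hx m hm).2 hT
      obtain ⟨s, hs, r, hr⟩ := (h m hm a b).resolve_left hT
      have ht : x * r + (1 - x) * s ∉ m := fun hmem => hs <| by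
        have := m.sub_mem hmem (m.mul_mem_left (r - s) hx0)
        convert! this using 1
        ring
      refine ⟨(x * r + (1 - x) * s) * s, fun hmem => (hp.mem_or_mem hmem).elim ht hs,
        ⟨r * s, ?_⟩, ⟨s * s, ?_⟩⟩
      · linear_combination (x * r + (1 - x) * s) * hr - r * x * hr
      · linear_combination (-(s * x)) * hr
  have ha : (x * a + (1 - x) * b) ∣ a := dvd_of_forall_isMaximal fun m hm =>
    let ⟨s, hs, hsa, _⟩ := key m hm
    ⟨s, hs, hsa⟩
  have hb : (x * a + (1 - x) * b) ∣ b := dvd_of_forall_isMaximal fun m hm =>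
    let ⟨s, hs, _, hsb⟩ := key m hm
    ⟨s, hs, hsb⟩
  refine ⟨⟨x * a + (1 - x) * b, le_antisymm ?_ ?_⟩⟩
  · rw [Ideal.span_le, Set.pair_subset_iff]
    exact ⟨Ideal.mem_span_singleton.2 ha, Ideal.mem_span_singleton.2 hb⟩
  · refine (Ideal.span_singleton_le_iff_mem _).2 ?_
    exact Ideal.mem_span_pair.2 ⟨x, 1 - x, rfl⟩

/-- In a Bézout domain every fraction can be written in lowest terms. -/
theorem exists_isCoprime_mul_eq [IsDomain R] [IsBezout R] (a : R) {b : R} (hb : b ≠ 0) :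
    ∃ a' b' : R, IsCoprime a' b' ∧ a * b' = a' * b := by
  obtain ⟨g, hg⟩ := (IsBezout.iff_span_pair_isPrincipal.1 ‹IsBezout R› a b).principal
  change Ideal.span {a, b} = Ideal.span {g} at hg
  have ha : a ∈ Ideal.span {g} := hg ▸ Ideal.mem_span_pair.2 ⟨1, 0, by ring⟩
  have hb' : b ∈ Ideal.span {g} := hg ▸ Ideal.mem_span_pair.2 ⟨0, 1, by ring⟩
  have hgm : g ∈ Ideal.span {a, b} := hg ▸ Ideal.mem_span_singleton_self g
  obtain ⟨a', rfl⟩ := Ideal.mem_span_singleton.1 ha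
  obtain ⟨b', rfl⟩ := Ideal.mem_span_singleton.1 hb'
  obtain ⟨u, v, huv⟩ := Ideal.mem_span_pair.1 hgm
  have hg0 : g ≠ 0 := left_ne_zero_of_mul hb
  exact ⟨a', b', ⟨u, v, mul_left_cancel₀ hg0 (by linear_combination huv)⟩, by ring⟩

end CommRing

section Field

variable {F : Type*} [Field F]

theorem IsFractionSubring.exists_isCoprime {H : Subring F} (hH : IsFractionSubring H)
    [IsBezout H] (x : F) : ∃ a b : H, IsCoprime a b ∧ x * b = a := by
  obtain ⟨a, b, hb, hx⟩ := hH x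
  obtain ⟨a', b', hc, h⟩ := exists_isCoprime_mul_eq a hb
  refine ⟨a', b', hc, ?_⟩
  have hb0 : (b : F) ≠ 0 := fun h => hb (Subtype.ext h)
  have h' : (a : F) * b' = a' * b := by exact_mod_cast congrArg (Subtype.val) h
  exact mul_right_cancel₀ hb0 (by linear_combination (b' : F) * hx + h')

/-- The localization of a Bézout subring at a maximal ideal, as a valuation subring of the
fraction field. -/
def localizationAt (H : Subring F) (hH : IsFractionSubring H) (hB : IsBezout H)
    (m : Ideal H) (hm : m.IsMaximal) : ValuationSubring F where
  carrier := {x | ∃ a b : H, b ∉ m ∧ x * b = a}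
  one_mem' := ⟨1, 1, (Ideal.ne_top_iff_one m).1 hm.ne_top, by simp⟩
  zero_mem' := ⟨0, 1, (Ideal.ne_top_iff_one m).1 hm.ne_top, by simp⟩
  mul_mem' := by
    rintro x y ⟨a, b, hb, hx⟩ ⟨c, d, hd, hy⟩
    refine ⟨a * c, b * d, fun h => (hm.isPrime.mem_or_mem h).elim hb hd, ?_⟩
    push_cast
    rw [← hx, ← hy]
    ring
  add_mem' := by
    rintro x y ⟨a, b, hb, hx⟩ ⟨c, d, hd, hy⟩
    refine ⟨a * d + b * c, b * d, fun h => (hm.isPrime.mem_or_mem h).elim hb hd, ?_⟩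
    push_cast
    rw [← hx, ← hy]
    ring
  neg_mem' := by
    rintro x ⟨a, b, hb, hx⟩
    exact ⟨-a, b, hb, by push_cast; rw [← hx]; ring⟩
  mem_or_inv_mem' := by
    intro x
    obtain ⟨a, b, ⟨u, v, huv⟩, hx⟩ := hH.exists_isCoprime x
    by_cases hb : b ∈ m
    · right
      have ha : a ∉ m := fun ha => (Ideal.ne_top_iff_one m).1 hm.ne_top
        (huv ▸ m.add_mem (m.mul_mem_left u ha) (m.mul_mem_left v hb))
      refine ⟨b, a, ha, ?_⟩
      have hx0 : x ≠ 0 := by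
        rintro rfl
        exact ha (by rw [show a = 0 from Subtype.ext (by simpa using hx.symm)]; exact m.zero_mem)
      rw [← hx, inv_mul_cancel_left₀ hx0]
    · exact .inl ⟨a, b, hb, hx⟩

theorem mem_localizationAt {H : Subring F} {hH : IsFractionSubring H} {hB : IsBezout H}
    {m : Ideal H} {hm : m.IsMaximal} {x : F} :
    x ∈ localizationAt H hH hB m hm ↔ ∃ a b : H, b ∉ m ∧ x * b = a := Iff.rfl

theorem mem_of_forall_mem_localizationAt {H : Subring F} (hH : IsFractionSubring H)
    (hB : IsBezout H) {x : F} (hx : ∀ m hm, x ∈ localizationAt H hH hB m hm) : x ∈ H := by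
  obtain ⟨a, b, ⟨u, v, huv⟩, hab⟩ := hH.exists_isCoprime x
  have hunit : IsUnit b := by
    by_contra hb
    obtain ⟨m, hm, hbm⟩ := exists_max_ideal_of_mem_nonunits hb
    obtain ⟨c, d, hd, hcd⟩ := mem_localizationAt.1 (hx m hm)
    have h : a * d = b * c := Subtype.ext (by push_cast; rw [← hab, ← hcd]; ring)
    have ha : a ∈ m := (hm.isPrime.mem_or_mem (h ▸ m.mul_mem_right c hbm)).resolve_right hd
    exact (Ideal.ne_top_iff_one m).1 hm.ne_top
      (huv ▸ m.add_mem (m.mul_mem_left u ha) (m.mul_mem_left v hbm))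
  obtain ⟨e, he⟩ := hunit.exists_right_inv
  have he' : (b : F) * e = 1 := by exact_mod_cast congrArg Subtype.val he
  have : x = a * e := by rw [← hab, mul_assoc, he', mul_one]
  rw [this]
  exact H.mul_mem a.2 e.2

open Polynomial in
theorem valuation_aeval_of_monic {Γ : Type*} [LinearOrderedCommGroupWithZero Γ]
    (v : Valuation F Γ) (hv : ∀ n : ℤ, v n ≤ 1) {u : F} (hu : 1 < v u) {g : ℤ[X]}
    (hg : g.Monic) : v (aeval u g) = v u ^ g.natDegree := by
  have hsum : v (∑ i ∈ Finset.range g.natDegree, (g.coeff i : F) * u ^ i) <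
      v (u ^ g.natDegree) := by
    refine v.map_sum_lt ?_ fun i hi => ?_
    · rw [map_pow]
      exact pow_ne_zero _ (zero_lt_one.trans hu).ne'
    · rw [map_mul, map_pow, map_pow]
      exact (mul_le_of_le_one_left' (hv _)).trans_lt
        (pow_lt_pow_right₀ hu (Finset.mem_range.1 hi))
  conv_lhs => rw [hg.as_sum]
  simp only [map_add, map_sum, map_mul, map_pow, aeval_X, eq_intCast, map_intCast]
  rw [v.map_add_eq_of_lt_left hsum, map_pow]

theorem valuation_intCast_le_one (v : ValuationSubring F) (n : ℤ) : v.valuation n ≤ 1 :=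
  (v.valuation_le_one_iff _).2 (intCast_mem v n)

open Polynomial in
theorem aeval_int_mem (v : ValuationSubring F) {u : F} (hu : u ∈ v) (g : ℤ[X]) :
    aeval u g ∈ v := by
  rw [aeval_eq_sum_range]
  exact sum_mem fun i _ => zsmul_mem (pow_mem hu i) _

open Polynomial in
/-- Given finitely many valuation subrings, some monic integral polynomial has value a unit at `u`
for each of them that contains `u`. -/
theorem exists_monic_valuation_aeval_eq_one (S : Finset (ValuationSubring F)) (u : F) :
    ∃ f : ℤ[X], f.Monic ∧ f.natDegree ≠ 0 ∧
      ∀ v ∈ S, u ∈ v → v.valuation (aeval u f) = 1 := by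
  classical
  have hex : ∀ v : ValuationSubring F, ∃ g : ℤ[X], g.Monic ∧
      ((∃ g' : ℤ[X], g'.Monic ∧ v.valuation (aeval u g') < 1) →
        v.valuation (aeval u g) < 1) := fun v => by
    by_cases h : ∃ g' : ℤ[X], g'.Monic ∧ v.valuation (aeval u g') < 1
    · obtain ⟨g, hg, hlt⟩ := h
      exact ⟨g, hg, fun _ => hlt⟩
    · exact ⟨1, monic_one, fun h' => absurd h' h⟩
  choose g hg hlt using hex
  have hP : (X * ∏ v ∈ S, g v).Monic := monic_X.mul (monic_prod_of_monic _ _ fun v _ => hg v)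
  have hdeg : 0 < (X * ∏ v ∈ S, g v).natDegree := by
    rw [monic_X.natDegree_mul (monic_prod_of_monic _ _ fun v _ => hg v), natDegree_X]
    omega
  have hdeg' : degree (1 : ℤ[X]) < degree (X * ∏ v ∈ S, g v) := by
    rw [degree_one]
    exact natDegree_pos_iff_degree_pos.1 hdeg
  have hf : (X * ∏ v ∈ S, g v + 1).Monic := hP.add_of_left hdeg'
  refine ⟨_, hf, ?_, fun v hv hu => ?_⟩
  · rw [← C_1, natDegree_add_C]
    exact hdeg.ne'
  · by_cases h : ∃ g' : ℤ[X], g'.Monic ∧ v.valuation (aeval u g') < 1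
    · have hsmall : v.valuation (aeval u (X * ∏ w ∈ S, g w)) < 1 := by
        rw [← Finset.mul_prod_erase S g hv, mul_left_comm, map_mul, map_mul]
        exact mul_lt_one_of_lt_of_le (hlt v h)
          ((v.valuation_le_one_iff _).2 (aeval_int_mem v hu _))
      rw [map_add, map_one, Valuation.map_add_eq_of_lt_right, map_one]
      rwa [map_one]
    · push Not at h
      exact le_antisymm ((v.valuation_le_one_iff _).2 (aeval_int_mem v hu _)) (h _ hf)

/-- If `u` lies in one of finitely many valuation subrings `v`, it is a fraction of elements of
their intersection whose denominator is a unit of `v`. -/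
theorem exists_denominator (S : Finset (ValuationSubring F)) {v : ValuationSubring F}
    (hv : v ∈ S) {u : F} (hu : u ∈ v) :
    ∃ q : F, v.valuation q = 1 ∧ ∀ w ∈ S, q ∈ w ∧ q * u ∈ w := by
  obtain ⟨f, hf, hdeg, hval⟩ := exists_monic_valuation_aeval_eq_one S u
  refine ⟨(Polynomial.aeval u f)⁻¹, by rw [map_inv₀, hval v hv hu, inv_one], fun w hw => ?_⟩
  by_cases huw : u ∈ w
  · have hq : (Polynomial.aeval u f)⁻¹ ∈ w := by
      rw [← w.valuation_le_one_iff, map_inv₀, hval w hw huw, inv_one]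
    exact ⟨hq, mul_mem hq huw⟩
  · have h1 : 1 < w.valuation u := by
      rwa [← not_le, w.valuation_le_one_iff]
    have h0 : 0 < w.valuation u := zero_lt_one.trans h1
    have hfu := valuation_aeval_of_monic w.valuation (valuation_intCast_le_one w) h1 hf
    have hle : w.valuation u ≤ w.valuation u ^ f.natDegree := le_self_pow₀ h1.le hdeg
    rw [← w.valuation_le_one_iff, ← w.valuation_le_one_iff, map_mul, map_inv₀, hfu]
    exact ⟨inv_le_one_of_one_le₀ (h1.le.trans hle), inv_mul_le_one_of_le₀ hle (h0.le.trans hle)⟩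

/-- The center of a valuation subring on a subring it contains. -/
def center (H : Subring F) (v : ValuationSubring F) (h : H ≤ v.toSubring) : Ideal H :=
  (IsLocalRing.maximalIdeal v).comap (Subring.inclusion h)

theorem center_isPrime (H : Subring F) (v : ValuationSubring F) (h : H ≤ v.toSubring) :
    (center H v h).IsPrime :=
  Ideal.comap_isPrime _ _

theorem mem_center {H : Subring F} {v : ValuationSubring F} {h : H ≤ v.toSubring} {x : H} :
    x ∈ center H v h ↔ v.valuation x < 1 := by
  rw [center, Ideal.mem_comap, v.valuation_lt_one_iff]
  rfl

theorem isUnit_of_forall_valuation_eq_one {H : Subring F} {S : Finset (ValuationSubring F)}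
    (hne : S.Nonempty) (hS : ∀ x, x ∈ H ↔ ∀ v ∈ S, x ∈ v) {x : H}
    (hx : ∀ v ∈ S, v.valuation (x : F) = 1) : IsUnit x := by
  obtain ⟨v, hv⟩ := hne
  have hx0 : (x : F) ≠ 0 := fun h => by simpa [h] using hx v hv
  have hinv : (x : F)⁻¹ ∈ H := (hS _).2 fun w hw => by
    rw [← w.valuation_le_one_iff, map_inv₀, hx w hw, inv_one]
  exact IsUnit.of_mul_eq_one ⟨_, hinv⟩ (Subtype.ext (mul_inv_cancel₀ hx0))

/-- Every maximal ideal of a finite intersection of valuation subrings is the center of one of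
them. -/
theorem exists_eq_center {H : Subring F} {S : Finset (ValuationSubring F)}
    (hne : S.Nonempty) (hS : ∀ x, x ∈ H ↔ ∀ v ∈ S, x ∈ v) {m : Ideal H} (hm : m.IsMaximal) :
    ∃ v : S, m = center H v (fun x hx => (hS x).1 hx v v.2) := by
  obtain ⟨v₀, hv₀⟩ := hne
  have hsub : (m : Set H) ⊆ ⋃ v ∈ ((Finset.univ : Finset S) : Set S),
      (center H v (fun x hx => (hS x).1 hx v v.2) : Set H) := by
    intro x hxm
    by_contra hx
    simp only [Finset.coe_univ, Set.mem_univ, Set.iUnion_true, Set.mem_iUnion, not_exists,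
      SetLike.mem_coe, mem_center, not_lt] at hx
    refine hm.ne_top (Ideal.eq_top_of_isUnit_mem m hxm
      (isUnit_of_forall_valuation_eq_one ⟨v₀, hv₀⟩ hS fun v hv => ?_))
    exact le_antisymm ((v.valuation_le_one_iff _).2 ((hS x).1 x.2 v hv)) (hx ⟨v, hv⟩)
  obtain ⟨v, -, hle⟩ := (Ideal.subset_union_prime (⟨v₀, hv₀⟩ : S) (⟨v₀, hv₀⟩ : S)
    fun v _ _ _ => center_isPrime H v _).1 hsub
  exact ⟨v, hm.eq_of_le (center_isPrime H v _).ne_top hle⟩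

theorem semilocal_of_mem_iff {H : Subring F} {S : Finset (ValuationSubring F)}
    (hne : S.Nonempty) (hS : ∀ x, x ∈ H ↔ ∀ v ∈ S, x ∈ v) : Semilocal H := by
  refine (Set.finite_range fun v : S =>
    center H v (fun x hx => (hS x).1 hx v v.2)).subset fun m hm => ?_
  obtain ⟨v, hv⟩ := exists_eq_center hne hS hm
  exact ⟨v, hv.symm⟩

theorem exists_notMem_center_dvd {H : Subring F} {S : Finset (ValuationSubring F)}
    (hS : ∀ x, x ∈ H ↔ ∀ v ∈ S, x ∈ v) (v : S) {a b : H} (ha : a ≠ 0)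
    (hab : (b : F) / a ∈ (v : ValuationSubring F)) :
    ∃ s ∉ center H v (fun x hx => (hS x).1 hx v v.2), a ∣ s * b := by
  obtain ⟨q, hq, hmem⟩ := exists_denominator S v.2 hab
  have ha0 : (a : F) ≠ 0 := fun h => ha (Subtype.ext h)
  refine ⟨⟨q, (hS q).2 fun w hw => (hmem w hw).1⟩, fun h => (mem_center.1 h).ne hq,
    ⟨q * (b / a), (hS _).2 fun w hw => (hmem w hw).2⟩, Subtype.ext ?_⟩
  push_cast
  field_simp

theorem isBezout_of_mem_iff {H : Subring F} {S : Finset (ValuationSubring F)}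
    (hne : S.Nonempty) (hS : ∀ x, x ∈ H ↔ ∀ v ∈ S, x ∈ v) : IsBezout H := by
  refine (semilocal_of_mem_iff hne hS).isBezout fun m hm a b => ?_
  have h1 : (1 : H) ∉ m := (Ideal.ne_top_iff_one m).1 hm.ne_top
  obtain ⟨v, rfl⟩ := exists_eq_center hne hS hm
  by_cases ha : a = 0
  · exact .inr ⟨1, h1, by simp [ha]⟩
  by_cases hb : b = 0
  · exact .inl ⟨1, h1, by simp [hb]⟩
  rcases v.1.mem_or_inv_mem ((b : F) / a) with h | h
  · exact .inl (exists_notMem_center_dvd hS v ha h)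
  · rw [inv_div] at h
    exact .inr (exists_notMem_center_dvd hS v hb h)

end Field

theorem statement10 {F : Type*} [Field F] (H : Subring F) (hfrac : IsFractionSubring H) :
    (Semilocal H ∧ IsBezout H) ↔
      ∃ S : Finset (ValuationSubring F), S.Nonempty ∧
        (H : Set F) = ⋂ v ∈ S, (v : Set F) := by
  classical
  constructor
  · rintro ⟨hsemi, hB⟩
    have : Fintype {I : Ideal H | I.IsMaximal} := Set.Finite.fintype hsemi
    obtain ⟨m₀, hm₀⟩ := Ideal.exists_maximal H
    refine ⟨Finset.univ.image fun m : {I : Ideal H | I.IsMaximal} =>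
      localizationAt H hfrac hB m m.2, ⟨_, Finset.mem_image_of_mem _
        (Finset.mem_univ ⟨m₀, hm₀⟩)⟩, Set.Subset.antisymm ?_ ?_⟩
    · intro x hx
      simp only [Set.mem_iInter, Finset.mem_image, SetLike.mem_coe]
      rintro _ ⟨m, -, rfl⟩
      exact mem_localizationAt.2
        ⟨⟨x, hx⟩, 1, (Ideal.ne_top_iff_one _).1 m.2.ne_top, by simp⟩
    · intro x hx
      simp only [Set.mem_iInter, Finset.mem_image, SetLike.mem_coe] at hx
      exact mem_of_forall_mem_localizationAt hfrac hB fun m hm =>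
        hx _ ⟨⟨m, hm⟩, Finset.mem_univ _, rfl⟩
  · rintro ⟨S, hne, hS⟩
    have hmem : ∀ x, x ∈ H ↔ ∀ v ∈ S, x ∈ v := fun x => by
      rw [← SetLike.mem_coe, hS]
      simp
    exact ⟨semilocal_of_mem_iff hne hmem, isBezout_of_mem_iff hne hmem⟩

end SosPaper
end
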